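/- arXiv:2405.09010 — 10 statements merged into one kernel-verified Lean document; each statement's English description precedes it below -/
import Mathlib

section
/- Let q be a prime power and k, r positive integers. If there exist scalars ξ_1, …, ξ_r in the finite field F_q such that the k×r Vandermonde matrix V_k(ξ_1, …, ξ_r) is super-regular, then for every divisor m of q−1 with m < k, one has q ≥ r·m + 1. -/
/-- The `k × r` Vandermonde matrix whose (0-based) row `i`, column `j` entry is `ξ j ^ i`
(i.e. 1-based entry `(i,j)` is `ξ_j ^ (i-1)`). -/
def vand {F : Type*} [Field F] (k r : ℕ) (ξ : Fin r → F) : Matrix (Fin k) (Fin r) F :=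
  Matrix.of fun i j => ξ j ^ (i : ℕ)

/-- A matrix over a field is super-regular if every square submatrix
(formed by any set of rows and an equally sized set of columns) is nonsingular. -/
def SuperRegular {F : Type*} [Field F] {k r : ℕ} (M : Matrix (Fin k) (Fin r) F) : Prop :=
  ∀ (ℓ : ℕ) (ri : Fin ℓ → Fin k) (ci : Fin ℓ → Fin r),
    Function.Injective ri → Function.Injective ci → (M.submatrix ri ci).det ≠ 0

theorem SuperRegular.entry_ne_zero {F : Type*} [Field F] {k r : ℕ}
    {M : Matrix (Fin k) (Fin r) F} (h : SuperRegular M) (i : Fin k) (j : Fin r) : M i j ≠ 0 := by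
  simpa using h 1 (fun _ => i) (fun _ => j)
    (Function.injective_of_subsingleton _) (Function.injective_of_subsingleton _)

theorem SuperRegular.minor_two_ne_zero {F : Type*} [Field F] {k r : ℕ}
    {M : Matrix (Fin k) (Fin r) F} (h : SuperRegular M) {i i' : Fin k} {j j' : Fin r}
    (hi : i ≠ i') (hj : j ≠ j') : M i j * M i' j' - M i j' * M i' j ≠ 0 := by
  have := h 2 ![i, i'] ![j, j'] (by simpa [Function.Injective, Fin.forall_fin_two, eq_comm] using hi)
    (by simpa [Function.Injective, Fin.forall_fin_two, eq_comm] using hj)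
  rwa [Matrix.det_fin_two] at this

/-- A finite family of elements of a field with pairwise distinct values, all of which are
`n`-th roots of unity, has at most `n` members. -/
theorem le_of_injective_of_pow_eq_one {F : Type*} [Field F] {n r : ℕ} (hn : 0 < n)
    (f : Fin r → F) (hf : Function.Injective f) (h : ∀ j, f j ^ n = 1) : r ≤ n := by
  classical
  calc r = (Finset.univ.image f).card := by simp [Finset.card_image_of_injective _ hf]
    _ ≤ (Polynomial.nthRoots n (1 : F)).toFinset.card := by
      refine Finset.card_le_card fun x hx => ?_
      obtain ⟨j, -, rfl⟩ := Finset.mem_image.mp hx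
      simpa [Polynomial.mem_nthRoots hn] using h j
    _ ≤ (Polynomial.nthRoots n (1 : F)).card := Multiset.toFinset_card_le _
    _ ≤ n := Polynomial.card_nthRoots n 1

theorem stmt_0 {F : Type*} [Field F] [Fintype F] (q k r : ℕ)
    (hq : Fintype.card F = q) (hk : 0 < k) (hr : 0 < r)
    (ξ : Fin r → F) (hsr : SuperRegular (vand k r ξ)) :
    ∀ m : ℕ, m ∣ q - 1 → m < k → q ≥ r * m + 1 := by
  rintro m ⟨n, hn⟩ hmk
  have hq1 : 1 < q := hq ▸ Fintype.one_lt_card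
  have hm : 0 < m := Nat.pos_of_ne_zero (by rintro rfl; omega)
  have hn0 : 0 < n := Nat.pos_of_ne_zero (by rintro rfl; omega)
  have hne (j : Fin r) : ξ j ≠ 0 := by
    have h := hsr.entry_ne_zero ⟨m, hmk⟩ j
    rintro h0
    simp [vand, h0, hm.ne'] at h
  have hinj : Function.Injective fun j => ξ j ^ m := by
    intro j j' h
    by_contra hj
    have hi : (⟨0, hk⟩ : Fin k) ≠ ⟨m, hmk⟩ := by simp [hm.ne]
    refine hsr.minor_two_ne_zero hi hj ?_
    simpa [vand, sub_eq_zero] using h.symm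
  have hrn : r ≤ n := le_of_injective_of_pow_eq_one hn0 _ hinj fun j => by
    rw [← pow_mul, ← hn, ← hq, FiniteField.pow_card_sub_one_eq_one _ (hne j)]
  have : r * m ≤ n * m := Nat.mul_le_mul_right m hrn
  rw [mul_comm n m] at this
  omega
end

section
/- Let q = 2^w be a power of 2 and let k, r be positive integers with k > r. If there exist pairwise distinct nonzero scalars ξ_1, …, ξ_r in F_q such that the k×r Vandermonde matrix V_k(ξ_1, …, ξ_r) is super-regular, then q ≥ 2^r. -/
open Polynomial in
/-- A set of columns whose nodes sum to zero yields a singular square submatrix: the coefficients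
of `∏ (X - ξ j)` give a linear relation between the rows `0, …, ℓ - 2, ℓ`. -/
theorem SuperRegular.sum_ne_zero {F : Type*} [Field F] {k r : ℕ} {ξ : Fin r → F}
    (hkr : r < k) (hsr : SuperRegular (vand k r ξ)) {S : Finset (Fin r)} (hS : S.Nonempty) :
    ∑ j ∈ S, ξ j ≠ 0 := by
  intro hsum
  obtain ⟨m, hm⟩ : ∃ m, S.card = m + 1 := Nat.exists_eq_succ_of_ne_zero hS.card_pos.ne'
  have hmr : m + 1 ≤ r := by simpa [hm] using S.card_le_univ
  set P : F[X] := ∏ j ∈ S, (X - C (ξ j)) with hP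
  have hdeg : P.natDegree = m + 1 := by rw [hP, natDegree_finsetProd_X_sub_C_eq_card, hm]
  have hlead : P.coeff (m + 1) = 1 := by
    rw [← hdeg]
    exact monic_prod_of_monic _ _ fun j _ => monic_X_sub_C (ξ j)
  have hnext : P.coeff m = 0 := by
    have h := prod_X_sub_C_coeff_card_pred S ξ hS.card_pos
    rwa [hm, Nat.add_sub_cancel, hsum, neg_zero] at h
  let row : Fin (m + 1) → Fin k := fun i =>
    ⟨if (i : ℕ) < m then i else m + 1, by split_ifs <;> omega⟩
  have hrow : Function.Injective row := by
    intro a b hab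
    have := congrArg Fin.val hab
    simp only [row] at this
    ext
    split_ifs at this <;> omega
  refine hsr (m + 1) row (S.orderEmbOfFin hm) hrow (S.orderEmbOfFin hm).injective ?_
  rw [← Matrix.exists_vecMul_eq_zero_iff]
  refine ⟨fun i => P.coeff (row i), fun h => ?_, ?_⟩
  · simpa [row, hlead] using congrFun h (Fin.last m)
  · ext j
    have heval : P.eval (ξ (S.orderEmbOfFin hm j)) = 0 := by
      rw [hP, eval_prod]
      exact Finset.prod_eq_zero (S.orderEmbOfFin_mem hm j) (by simp)
    rw [eval_eq_sum_range, hdeg, Finset.sum_range_succ, Finset.sum_range_succ, hnext,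
      Finset.sum_range] at heval
    simpa [Matrix.vecMul, dotProduct, Fin.sum_univ_castSucc, row, vand] using heval

theorem stmt_2 {F : Type*} [Field F] [Fintype F] (w k r : ℕ)
    (hq : Fintype.card F = 2 ^ w) (hr : 0 < r) (hkr : r < k)
    (ξ : Fin r → F) (hdist : Function.Injective ξ) (hne : ∀ j, ξ j ≠ 0)
    (hsr : SuperRegular (vand k r ξ)) :
    Fintype.card F ≥ 2 ^ r := by
  have : CharP F 2 := charP_of_card_eq_prime_pow hq
  have hinj : Function.Injective fun S : Finset (Fin r) => ∑ j ∈ S, ξ j := by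
    intro S T hST
    by_contra hne'
    refine hsr.sum_ne_zero hkr (Finset.symmDiff_nonempty.2 hne') ?_
    have hS := Finset.sum_inter_add_sum_sdiff S T ξ
    have hT := Finset.sum_inter_add_sum_sdiff T S ξ
    rw [Finset.inter_comm] at hT
    have hdiff : ∑ j ∈ S \ T, ξ j = ∑ j ∈ T \ S, ξ j :=
      add_left_cancel (hS.trans (hST.trans hT.symm))
    rw [symmDiff_def, Finset.sup_eq_union, Finset.sum_union disjoint_sdiff_sdiff, hdiff,
      CharTwo.add_self_eq_zero]
  simpa using Fintype.card_le_of_injective _ hinj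
end

section
/- Let F_q be a finite field and let k, r be positive integers. If q > 1 + C(k,2)·Σ_{ℓ=2}^{r} C(r,ℓ)·C(k−2,ℓ−2) (where C(a,b) denotes the binomial coefficient), then there exist nonzero scalars ξ_1, …, ξ_r in F_q such that the k×r Vandermonde matrix V_k(ξ_1, …, ξ_r) is super-regular. -/
open Polynomial in
/-- Every polynomial supported on `#J` exponents from `{0, …, k - 1}` that vanishes at the points
`ξ j`, `j ∈ J`, is zero, for every set `J` of indices below `m`. -/
def NoSparseRelation {F : Type*} [Field F] (k m : ℕ) (ξ : ℕ → F) : Prop :=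
  ∀ J ⊆ Finset.range m, ∀ I ⊆ Finset.range k, I.card = J.card →
    ∀ p : F[X], p.support ⊆ I → (∀ j ∈ J, p.eval (ξ j) = 0) → p = 0

/-- The sum of the maxima of all `s`-element subsets of `{1, …, n}`. -/
theorem sum_sup_powersetCard_Icc (n s : ℕ) :
    ∑ I ∈ (Finset.Icc 1 n).powersetCard s, I.sup id = s * (n + 1).choose (s + 1) := by
  induction n generalizing s with
  | zero =>
    cases s with
    | zero => simp
    | succ s =>
      rw [Finset.powersetCard_eq_empty.2 (by simp), Nat.choose_eq_zero_of_lt (by omega)]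
      simp
  | succ n ih =>
    cases s with
    | zero => simp
    | succ s =>
      have hn : n + 1 ∉ Finset.Icc 1 n := by simp
      have hins : Finset.Icc 1 (n + 1) = insert (n + 1) (Finset.Icc 1 n) := by
        ext x; simp; omega
      have hsub : ∀ I ∈ (Finset.Icc 1 n).powersetCard s, I ⊆ Finset.Icc 1 n :=
        fun I hI => (Finset.mem_powersetCard.1 hI).1
      rw [hins, Finset.powersetCard_succ_insert hn, Finset.sum_union, ih, Finset.sum_image]
      · have hmax : ∀ I ∈ (Finset.Icc 1 n).powersetCard s,
            (insert (n + 1) I).sup id = n + 1 := by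
          intro I hI
          rw [Finset.sup_insert, id, sup_eq_left, Finset.sup_le_iff]
          intro x hx
          have := Finset.mem_Icc.1 (hsub I hI hx)
          simp only [id]; omega
        rw [Finset.sum_congr rfl hmax, Finset.sum_const, Finset.card_powersetCard]
        simp only [Nat.card_Icc, Nat.add_sub_cancel, smul_eq_mul]
        have h1 := Nat.add_one_mul_choose_eq n s
        have h2 := Nat.choose_succ_succ (n + 1) (s + 1)
        simp only [Nat.succ_eq_add_one] at h2
        rw [h2]
        linarith
      · intro A hA B hB h
        have hA' : n + 1 ∉ A := fun h => hn (hsub A hA h)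
        have hB' : n + 1 ∉ B := fun h => hn (hsub B hB h)
        rw [← Finset.erase_insert hA', ← Finset.erase_insert hB']
        exact congrArg (fun S => S.erase (n + 1)) h
      · rw [Finset.disjoint_left]
        intro A hA hA'
        obtain ⟨B, -, rfl⟩ := Finset.mem_image.1 hA'
        exact hn ((Finset.mem_powersetCard.1 hA).1 (Finset.mem_insert_self _ _))

theorem choose_mul_choose_le (k m r s : ℕ) (hm : m + 1 ≤ r) (hs : s < m) :
    m.choose (s + 1) * ((s + 1) * k.choose (s + 2)) ≤
      k.choose 2 * (r.choose (s + 2) * (k - 2).choose s) := by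
  have hr : (m + 1).choose (s + 2) ≤ r.choose (s + 2) := Nat.choose_le_choose _ hm
  have h1 : (m + 1) * m.choose (s + 1) = (m + 1).choose (s + 2) * (s + 2) :=
    Nat.add_one_mul_choose_eq m (s + 1)
  have h2 : k.choose (s + 2) * (s + 2).choose 2 = k.choose 2 * (k - 2).choose s := by
    have := Nat.choose_mul (n := k) (k := s + 2) (s := 2) (by omega)
    simpa using this
  have h3 : (s + 2).choose 2 * 2 = (s + 2) * (s + 1) := by
    have := Nat.add_one_mul_choose_eq (s + 1) 1
    simp only [Nat.choose_one_right] at this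
    exact this.symm
  refine le_of_mul_le_mul_left ?_ (Nat.two_pos)
  calc 2 * (m.choose (s + 1) * ((s + 1) * k.choose (s + 2)))
      ≤ (m + 1) * (m.choose (s + 1) * ((s + 1) * k.choose (s + 2))) :=
        Nat.mul_le_mul_right _ (by omega)
    _ = ((m + 1) * m.choose (s + 1)) * ((s + 1) * k.choose (s + 2)) := by ring
    _ = (m + 1).choose (s + 2) * (((s + 2) * (s + 1)) * k.choose (s + 2)) := by
        rw [h1]; ring
    _ = 2 * ((k.choose (s + 2) * (s + 2).choose 2) * (m + 1).choose (s + 2)) := by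
        rw [← h3]; ring
    _ ≤ 2 * ((k.choose (s + 2) * (s + 2).choose 2) * r.choose (s + 2)) := by gcongr
    _ = 2 * (k.choose 2 * (r.choose (s + 2) * (k - 2).choose s)) := by rw [h2]; ring

theorem sum_choose_mul_choose_le (k m r : ℕ) (hm : m + 1 ≤ r) :
    ∑ s ∈ Finset.range (m + 1), m.choose s * (s * k.choose (s + 1)) ≤
      k.choose 2 * ∑ l ∈ Finset.Icc 2 r, r.choose l * (k - 2).choose (l - 2) := by
  have hI : Finset.Icc 2 r = Finset.Ico 2 (r + 1) := by ext x; simp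
  rw [Finset.sum_range_succ', hI, Finset.sum_Ico_eq_sum_range, Finset.mul_sum]
  simp only [zero_mul, mul_zero, add_zero]
  calc _ ≤ ∑ s ∈ Finset.range m, k.choose 2 * (r.choose (s + 2) * (k - 2).choose s) :=
        Finset.sum_le_sum fun s hs =>
          choose_mul_choose_le k m r s hm (Finset.mem_range.1 hs)
    _ ≤ ∑ s ∈ Finset.range (r + 1 - 2), k.choose 2 * (r.choose (s + 2) * (k - 2).choose s) :=
        Finset.sum_le_sum_of_subset (Finset.range_subset_range.2 (by omega))
    _ = _ := Finset.sum_congr rfl fun s _ => by rw [add_comm 2 s, Nat.add_sub_cancel]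

open Polynomial in
/-- The points that are roots of some nonzero polynomial with exponents in `I ∪ {0}` vanishing at
`ξ j` for all `j ∈ J`. -/
def sparseRoots {F : Type*} [Field F] (ξ : ℕ → F) (J I : Finset ℕ) : Set F :=
  {x | ∃ p : F[X], p ≠ 0 ∧ p.support ⊆ insert 0 I ∧ (∀ j ∈ J, p.eval (ξ j) = 0) ∧ p.eval x = 0}

open Polynomial in
theorem ncard_sparseRoots_le {F : Type*} [Field F] {n m : ℕ} {ξ : ℕ → F}
    (h : NoSparseRelation (n + 1) m ξ) {J I : Finset ℕ} (hJ : J ⊆ Finset.range m)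
    (hI : I ⊆ Finset.Icc 1 n) (hc : I.card = J.card) :
    (sparseRoots ξ J I).ncard ≤ I.sup id := by
  classical
  rcases (sparseRoots ξ J I).eq_empty_or_nonempty with h0 | ⟨y, p, hp0, hpI, hpJ, -⟩
  · simp [h0]
  have h0I : 0 ∉ I := fun h0 => by simpa using hI h0
  have hIk : I ⊆ Finset.range (n + 1) := fun x hx => by
    have := Finset.mem_Icc.1 (hI hx)
    exact Finset.mem_range.2 (by omega)
  have hcoeff : ∀ q : F[X], q.support ⊆ insert 0 I → (∀ j ∈ J, q.eval (ξ j) = 0) →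
      q.coeff 0 = 0 → q = 0 := by
    intro q hqI hqJ hq0
    refine h J hJ I hIk hc q (fun x hx => ?_) hqJ
    rcases Finset.mem_insert.1 (hqI hx) with rfl | hx'
    · exact absurd hq0 (mem_support_iff.1 hx)
    · exact hx'
  have hp00 : p.coeff 0 ≠ 0 := fun h' => hp0 (hcoeff p hpI hpJ h')
  have hsub : sparseRoots ξ J I ⊆ (p.roots.toFinset : Set F) := by
    rintro x ⟨q, hq0, hqI, hqJ, hqx⟩
    have hq00 : q.coeff 0 ≠ 0 := fun h' => hq0 (hcoeff q hqI hqJ h')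
    have hz : C (q.coeff 0) * p - C (p.coeff 0) * q = 0 := by
      refine hcoeff _ ?_ ?_ ?_
      · intro i hi
        by_contra hiI
        have h1 : p.coeff i = 0 := notMem_support_iff.1 fun h' => hiI (hpI h')
        have h2 : q.coeff i = 0 := notMem_support_iff.1 fun h' => hiI (hqI h')
        exact mem_support_iff.1 hi (by simp [h1, h2])
      · intro j hj
        simp [hpJ j hj, hqJ j hj]
      · simp [mul_comm]
    have he := congrArg (eval x) hz
    simp only [eval_sub, eval_mul, eval_C, hqx, mul_zero, sub_zero, eval_zero] at he
    simp [hp0, (mul_eq_zero.1 he).resolve_left hq00]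
  calc (sparseRoots ξ J I).ncard ≤ (p.roots.toFinset : Set F).ncard :=
        Set.ncard_le_ncard hsub (Finset.finite_toSet _)
    _ = p.roots.toFinset.card := Set.ncard_coe_finset _
    _ ≤ p.roots.card := Multiset.toFinset_card_le _
    _ ≤ p.natDegree := card_roots' p
    _ ≤ I.sup id := by
        rcases Finset.mem_insert.1 (hpI (natDegree_mem_support_of_nonzero hp0)) with h' | h'
        · rw [h']; exact Nat.zero_le _
        · exact Finset.le_sup (f := id) h'

open Polynomial in
/-- A sparse polynomial relation among nonzero points can be shifted to involve the exponent `0`. -/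
theorem exists_shifted_sparse {F : Type*} [Field F] {n : ℕ} {I : Finset ℕ}
    (hI : I ⊆ Finset.range (n + 1)) (hne : I.Nonempty) {p : F[X]} (hp : p ≠ 0)
    (hpI : p.support ⊆ I) :
    ∃ I' ⊆ Finset.Icc 1 n, I'.card + 1 = I.card ∧ ∃ q : F[X], q ≠ 0 ∧
      q.support ⊆ insert 0 I' ∧ ∀ x ≠ 0, p.eval x = 0 → q.eval x = 0 := by
  set a := I.min' hne with ha
  have haI : a ∈ I := I.min'_mem hne
  have hmin : ∀ i ∈ I, a ≤ i := fun i hi => I.min'_le i hi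
  obtain ⟨q, rfl⟩ : X ^ a ∣ p := X_pow_dvd_iff.2 fun d hd =>
    notMem_support_iff.1 fun h => absurd (hmin d (hpI h)) (by omega)
  refine ⟨(I.erase a).image (· - a), ?_, ?_, q, right_ne_zero_of_mul hp, ?_, ?_⟩
  · intro i hi
    obtain ⟨b, hb, rfl⟩ := Finset.mem_image.1 hi
    have hb' := Finset.mem_erase.1 hb
    have h1 := hmin b hb'.2
    have h2 := Finset.mem_range.1 (hI hb'.2)
    have h3 := hb'.1
    exact Finset.mem_Icc.2 ⟨by omega, by omega⟩
  · rw [Finset.card_image_of_injOn, Finset.card_erase_add_one haI]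
    intro b hb c hc h
    have h1 := hmin b (Finset.mem_of_mem_erase hb)
    have h2 := hmin c (Finset.mem_of_mem_erase hc)
    simp only at h
    omega
  · intro i hi
    have h1 : i + a ∈ I := hpI (by
      rw [mem_support_iff, coeff_X_pow_mul]; exact mem_support_iff.1 hi)
    rcases Nat.eq_zero_or_pos i with rfl | hpos
    · exact Finset.mem_insert_self _ _
    · refine Finset.mem_insert_of_mem (Finset.mem_image.2 ⟨i + a, ?_, by simp⟩)
      exact Finset.mem_erase.2 ⟨by omega, h1⟩
  · intro x hx h
    rw [eval_mul, eval_pow, eval_X] at h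
    exact (mul_eq_zero.1 h).resolve_left (pow_ne_zero _ hx)

theorem exists_noSparseRelation {F : Type*} [Field F] [Fintype F] (n r : ℕ)
    (hq : 1 + (n + 1).choose 2 * ∑ l ∈ Finset.Icc 2 r, r.choose l * (n + 1 - 2).choose (l - 2) <
      Fintype.card F) (m : ℕ) (hm : m ≤ r) :
    ∃ ξ : ℕ → F, (∀ j, ξ j ≠ 0) ∧ NoSparseRelation (n + 1) m ξ := by
  classical
  induction m with
  | zero =>
    refine ⟨fun _ => 1, fun _ => one_ne_zero, fun J hJ I _ hc p hp _ => ?_⟩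
    obtain rfl : J = ∅ := by simpa using hJ
    obtain rfl : I = ∅ := by simpa using hc
    exact Polynomial.support_eq_empty.1 (Finset.subset_empty.1 hp)
  | succ m ih =>
    obtain ⟨ξ, hξ, hg⟩ := ih (by omega)
    let bad : Finset F := {0} ∪ (Finset.range m).powerset.biUnion fun J =>
      ((Finset.Icc 1 n).powersetCard J.card).biUnion fun I =>
        (Set.toFinite (sparseRoots ξ J I)).toFinset
    have hbad : bad.card < Fintype.card F := by
      refine lt_of_le_of_lt ?_ hq
      refine (Finset.card_union_le _ _).trans ?_
      rw [Finset.card_singleton]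
      refine Nat.add_le_add_left ?_ _
      refine le_trans ?_ (sum_choose_mul_choose_le (n + 1) m r hm)
      calc _ ≤ ∑ J ∈ (Finset.range m).powerset, J.card * (n + 1).choose (J.card + 1) := by
            refine Finset.card_biUnion_le.trans (Finset.sum_le_sum fun J hJ => ?_)
            rw [← sum_sup_powersetCard_Icc]
            refine Finset.card_biUnion_le.trans (Finset.sum_le_sum fun I hI => ?_)
            rw [← Set.ncard_eq_toFinset_card]
            have hI' := Finset.mem_powersetCard.1 hI
            exact ncard_sparseRoots_le hg (Finset.mem_powerset.1 hJ) hI'.1 hI'.2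
        _ = _ := by
            rw [Finset.sum_powerset_apply_card (fun s => s * (n + 1).choose (s + 1))]
            simp
    obtain ⟨x, hx⟩ : ∃ x, x ∉ bad := by
      by_contra! hall
      rw [Finset.eq_univ_iff_forall.2 hall, Finset.card_univ] at hbad
      exact lt_irrefl _ hbad
    have hx0 : x ≠ 0 := fun h => hx (by simp [bad, h])
    have hnew : ∀ j, Function.update ξ m x j ≠ 0 := fun j => by
      rcases eq_or_ne j m with rfl | hj
      · simpa using hx0
      · simpa [hj] using hξ j
    refine ⟨Function.update ξ m x, hnew, fun J hJ I hI hc p hp hv => ?_⟩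
    have hold : ∀ j ∈ J.erase m, Function.update ξ m x j = ξ j := fun j hj =>
      Function.update_of_ne (Finset.ne_of_mem_erase hj) _ _
    have hJe : J.erase m ⊆ Finset.range m := fun j hj => by
      have h1 := Finset.mem_range.1 (hJ (Finset.mem_of_mem_erase hj))
      have h2 := Finset.ne_of_mem_erase hj
      exact Finset.mem_range.2 (by omega)
    by_cases hmJ : m ∈ J
    · by_contra hp0
      have hcard := Finset.card_erase_add_one hmJ
      obtain ⟨I', hI', hcI, q, hq0, hqI, hqe⟩ :=
        exists_shifted_sparse hI (Finset.card_pos.1 (by omega)) hp0 hp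
      refine hx (Finset.mem_union_right _ (Finset.mem_biUnion.2 ⟨J.erase m,
        Finset.mem_powerset.2 hJe, Finset.mem_biUnion.2 ⟨I',
          Finset.mem_powersetCard.2 ⟨hI', by omega⟩, ?_⟩⟩))
      rw [Set.Finite.mem_toFinset]
      refine ⟨q, hq0, hqI, fun j hj => ?_, ?_⟩
      · rw [← hold j hj]
        exact hqe _ (hnew j) (hv j (Finset.mem_of_mem_erase hj))
      · exact hqe x hx0 (by simpa using hv m hmJ)
    · rw [Finset.erase_eq_of_notMem hmJ] at hold hJe
      exact hg J hJe I hI hc p hp fun j hj => by rw [← hold j hj]; exact hv j hj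

open Polynomial in
theorem NoSparseRelation.superRegular {F : Type*} [Field F] {k r : ℕ} {ξ : ℕ → F}
    (h : NoSparseRelation k r ξ) : SuperRegular (vand k r fun j => ξ j) := by
  classical
  intro l ri ci hri hci hdet
  obtain ⟨v, hv0, hv⟩ := Matrix.exists_vecMul_eq_zero_iff.2 hdet
  have hri' : Function.Injective fun i => (ri i : ℕ) := Fin.val_injective.comp hri
  have hci' : Function.Injective fun i => (ci i : ℕ) := Fin.val_injective.comp hci
  have hcoeff : ∀ d, (∑ i, C (v i) * X ^ (ri i : ℕ) : F[X]).coeff d =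
      ∑ i, if d = (ri i : ℕ) then v i else 0 := fun d => by
    simp [finsetSum_coeff, coeff_X_pow]
  have hp : (∑ i, C (v i) * X ^ (ri i : ℕ) : F[X]) = 0 := by
    refine h (Finset.univ.image fun j => (ci j : ℕ)) ?_ (Finset.univ.image fun i => (ri i : ℕ))
      ?_ ?_ _ ?_ ?_
    · intro j hj
      obtain ⟨i, -, rfl⟩ := Finset.mem_image.1 hj
      exact Finset.mem_range.2 (ci i).2
    · intro j hj
      obtain ⟨i, -, rfl⟩ := Finset.mem_image.1 hj
      exact Finset.mem_range.2 (ri i).2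
    · rw [Finset.card_image_of_injective _ hri', Finset.card_image_of_injective _ hci']
    · intro d hd
      by_contra hd'
      refine mem_support_iff.1 hd ((hcoeff d).trans (Finset.sum_eq_zero fun i _ => if_neg ?_))
      rintro rfl
      exact hd' (Finset.mem_image_of_mem _ (Finset.mem_univ i))
    · intro j hj
      obtain ⟨i, -, rfl⟩ := Finset.mem_image.1 hj
      have := congrFun hv i
      simpa [eval_finsetSum, Matrix.vecMul, dotProduct, vand] using this
  refine hv0 (funext fun i => ?_)
  have := hcoeff (ri i)
  rw [hp, coeff_zero, Finset.sum_eq_single i] at this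
  · simpa using this.symm
  · intro b _ hb
    exact if_neg fun h' => hb (hri' h').symm
  · simp

theorem stmt_4 {F : Type*} [Field F] [Fintype F] (k r : ℕ) (hk : 0 < k) (hr : 0 < r)
    (hq : Fintype.card F >
      1 + Nat.choose k 2 * ∑ ℓ ∈ Finset.Icc 2 r, Nat.choose r ℓ * Nat.choose (k - 2) (ℓ - 2)) :
    ∃ ξ : Fin r → F, (∀ j, ξ j ≠ 0) ∧ SuperRegular (vand k r ξ) := by
  obtain ⟨n, rfl⟩ := Nat.exists_eq_add_one.2 hk
  obtain ⟨ξ, hξ, hg⟩ := exists_noSparseRelation (F := F) n r hq r le_rfl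
  exact ⟨fun j => ξ j, fun j => hξ j, hg.superRegular⟩
end

section
/- Let F_q be a finite field, let k < q, let θ be a primitive element of F_q, and let e be an integer with 2 ≤ e ≤ q−1 such that e is coprime to q−1 and e−1 is coprime to q−1. Then the k×3 Vandermonde matrix V_k(1, θ, θ^e) has no singular 2×2 square submatrix. -/
/-- If `m - n` is coprime to the order of `θ` and `i ≠ j` are smaller than that order, then the
generalized Vandermonde minor of `θ ^ m, θ ^ n` with exponents `i, j` does not vanish. -/
theorem pow_mul_pow_ne_of_isCoprime {F : Type*} [Field F] {θ : F} {m n i j : ℕ}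
    (hi : i < orderOf θ) (hj : j < orderOf θ) (hij : i ≠ j)
    (h : IsCoprime ((m : ℤ) - n) (orderOf θ : ℤ)) :
    (θ ^ m) ^ i * (θ ^ n) ^ j ≠ (θ ^ n) ^ i * (θ ^ m) ^ j := by
  intro H
  have hfin : IsOfFinOrder θ := orderOf_pos_iff.mp (by omega)
  simp only [← pow_mul, ← pow_add] at H
  have hmod := (hfin.pow_eq_pow_iff_modEq).mp H
  have hdvd := Nat.modEq_iff_dvd.mp hmod
  have hfac : (orderOf θ : ℤ) ∣ ((m : ℤ) - n) * ((j : ℤ) - i) := by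
    convert hdvd using 1
    push_cast
    ring
  have hji := Nat.modEq_iff_dvd.mpr (h.symm.dvd_of_dvd_mul_left hfac)
  exact hij (hji.eq_of_lt_of_lt hi hj)


theorem stmt_5 {F : Type*} [Field F] [Fintype F] (k : ℕ) (hk : k < Fintype.card F)
    (θ : F) (hθ : orderOf θ = Fintype.card F - 1)
    (e : ℕ) (he2 : 2 ≤ e) (heq : e ≤ Fintype.card F - 1)
    (hcop : Nat.Coprime e (Fintype.card F - 1))
    (hcop' : Nat.Coprime (e - 1) (Fintype.card F - 1)) :
    ∀ (ri : Fin 2 → Fin k) (ci : Fin 2 → Fin 3),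
      Function.Injective ri → Function.Injective ci →
      ((vand k 3 ![1, θ, θ ^ e]).submatrix ri ci).det ≠ 0 := by
  intro ri ci hri hci
  have hcop₁ : IsCoprime (e : ℤ) (orderOf θ : ℤ) := by
    rw [hθ]
    exact Nat.isCoprime_iff_coprime.mpr hcop
  have hcop₂ : IsCoprime ((e : ℤ) - 1) (orderOf θ : ℤ) := by
    rw [hθ]
    have h := Nat.isCoprime_iff_coprime.mpr hcop'
    rwa [Nat.cast_sub (by omega), Nat.cast_one] at h
  have hdiff : ∀ a b : Fin 3, a ≠ b →
      IsCoprime (((![0, 1, e] a : ℕ) : ℤ) - (![0, 1, e] b : ℕ)) (orderOf θ : ℤ) := by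
    intro a b hab
    have hneg₂ : IsCoprime (1 - (e : ℤ)) (orderOf θ : ℤ) := by
      simpa using hcop₂.neg_left
    fin_cases a <;> fin_cases b <;>
      simp_all [isCoprime_one_left, IsCoprime.neg_left_iff, -Nat.isCoprime_iff_coprime]
  have hcol : ∀ a : Fin 3, (![1, θ, θ ^ e] : Fin 3 → F) a = θ ^ (![0, 1, e] a : ℕ) := by
    intro a
    fin_cases a <;> simp
  rw [Matrix.det_fin_two, sub_ne_zero]
  simp only [vand, Matrix.submatrix_apply, Matrix.of_apply, hcol]
  have h0 := (ri 0).isLt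
  have h1 := (ri 1).isLt
  exact pow_mul_pow_ne_of_isCoprime (by omega) (by omega)
    (fun h => zero_ne_one (hri (Fin.ext h)))
    (hdiff _ _ fun h => zero_ne_one (hci h))
end

section
/- Let q = p^w be a prime power with w > 1, let k < q, let θ be a primitive element of F_q, and let σ be a nontrivial field automorphism of F_q whose fixed field is the prime subfield F_p. Then the k×3 Vandermonde matrix V_k(1, θ, σ(θ)) has a singular 3×3 square submatrix if and only if there exist integers e_1, e_2 with 1 ≤ e_1 < e_2 ≤ k−1 and nonzero elements c_1, c_2 of the prime subfield F_p such that 1, θ, and σ(θ) are all roots of the polynomial f(x) = c_1 + c_2·x^{e_1} + x^{e_2}. -/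
theorem eq_zero_of_add_eq_zero_of_add_mul_eq_zero {F : Type*} [Field F] {a b y : F}
    (hy : y ≠ 1) (h₁ : a + b = 0) (h₂ : a + b * y = 0) : a = 0 ∧ b = 0 := by
  have hb : b = 0 :=
    (mul_eq_zero.mp (show b * (y - 1) = 0 by linear_combination h₂ - h₁)).resolve_right
      (sub_ne_zero.mpr hy)
  exact ⟨by simpa [hb] using h₁, hb⟩

/-- A nonzero linear relation among three powers that holds at `1`, `θ` and `σ θ` can be
normalised to a monic trinomial whose other two coefficients are nonzero and fixed by `σ`. -/
theorem exists_fixed_trinomial {F : Type*} [Field F] (σ : F ≃+* F) {θ : F} (hθ₀ : θ ≠ 0)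
    {i j l : ℕ} (hij : i < j) (hjl : j < l) (hne : ∀ e, 0 < e → e ≤ l → θ ^ e ≠ 1)
    {a b c : F} (habc : ¬(a = 0 ∧ b = 0 ∧ c = 0)) (h₁ : a + b + c = 0)
    (hθ : a * θ ^ i + b * θ ^ j + c * θ ^ l = 0)
    (hσ : a * σ θ ^ i + b * σ θ ^ j + c * σ θ ^ l = 0) :
    ∃ c₁ c₂ : F, σ c₁ = c₁ ∧ σ c₂ = c₂ ∧ c₁ ≠ 0 ∧ c₂ ≠ 0 ∧ c₁ + c₂ + 1 = 0 ∧
      c₁ + c₂ * θ ^ (j - i) + θ ^ (l - i) = 0 ∧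
      c₁ + c₂ * σ θ ^ (j - i) + σ θ ^ (l - i) = 0 := by
  obtain ⟨m, hm, rfl⟩ : ∃ m, 0 < m ∧ j = i + m := ⟨j - i, by lia, by lia⟩
  obtain ⟨n, hn, rfl⟩ : ∃ n, 0 < n ∧ l = i + m + n := ⟨l - (i + m), by lia, by lia⟩
  rw [show i + m - i = m by lia, show i + m + n - i = m + n by lia]
  have divide (x : F) (hx : x ≠ 0) (h : a * x ^ i + b * x ^ (i + m) + c * x ^ (i + m + n) = 0) :
      a + b * x ^ m + c * x ^ (m + n) = 0 :=
    (mul_eq_zero.mp (show x ^ i * (a + b * x ^ m + c * x ^ (m + n)) = 0 by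
      rw [← h]; ring)).resolve_left (pow_ne_zero _ hx)
  have hσθ₀ : σ θ ≠ 0 := (map_ne_zero σ).mpr hθ₀
  replace hθ := divide θ hθ₀ hθ
  replace hσ := divide (σ θ) hσθ₀ hσ
  have hc : c ≠ 0 := by
    rintro rfl
    obtain ⟨ha, hb⟩ := eq_zero_of_add_eq_zero_of_add_mul_eq_zero (hne m hm (by lia))
      (by simpa using h₁) (by simpa using hθ)
    exact habc ⟨ha, hb, rfl⟩
  have ha : a ≠ 0 := by
    rintro rfl
    refine hc (eq_zero_of_add_eq_zero_of_add_mul_eq_zero (a := b) (hne n hn (by lia))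
      (by simpa using h₁) ?_).2
    refine (mul_eq_zero.mp (show θ ^ m * (b + c * θ ^ n) = 0 by
      rw [← hθ]; ring)).resolve_left (pow_ne_zero _ hθ₀)
  have hb : b ≠ 0 := by
    rintro rfl
    exact hc (eq_zero_of_add_eq_zero_of_add_mul_eq_zero (hne (m + n) (by lia) (by lia))
      (by simpa using h₁) (by simpa using hθ)).2
  have normalise (x y : F) (h : a + b * x + c * y = 0) : a / c + b / c * x + y = 0 := by
    field_simp
    linear_combination h
  have k₁ : a / c + b / c + 1 = 0 := by simpa using normalise 1 1 (by simpa using h₁)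
  have kθ := normalise _ _ hθ
  have kσ := normalise _ _ hσ
  have hfixed : a / c - σ (a / c) = 0 ∧ b / c - σ (b / c) = 0 := by
    have e₁ := congrArg σ k₁
    have eθ := congrArg σ kθ
    simp only [map_add, map_mul, map_pow, map_one, map_zero] at e₁ eθ
    refine eq_zero_of_add_eq_zero_of_add_mul_eq_zero (y := σ θ ^ m) ?_ ?_ ?_
    · rw [← map_pow]
      exact (map_ne_one_iff σ σ.injective).mpr (hne m hm (by lia))
    · linear_combination k₁ - e₁
    · linear_combination kσ - eθ
  exact ⟨a / c, b / c, (sub_eq_zero.mp hfixed.1).symm, (sub_eq_zero.mp hfixed.2).symm,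
    div_ne_zero ha hc, div_ne_zero hb hc, k₁, kθ, kσ⟩

/-- A singular square submatrix of a Vandermonde matrix that uses all of its columns gives a
nonzero linear relation, with increasing exponents, among the rows involved. -/
theorem exists_row_relation_of_det_eq_zero {F : Type*} [Field F] {k r : ℕ} {ξ : Fin r → F}
    {ri : Fin r → Fin k} {ci : Fin r → Fin r} (hri : Function.Injective ri)
    (hci : Function.Injective ci) (h : ((vand k r ξ).submatrix ri ci).det = 0) :
    ∃ (s : Fin r → Fin k) (v : Fin r → F), StrictMono s ∧ v ≠ 0 ∧
      ∀ j, ∑ i, v i * ξ j ^ (s i : ℕ) = 0 := by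
  obtain ⟨v, hv, hvM⟩ := Matrix.exists_vecMul_eq_zero_iff.mpr h
  refine ⟨ri ∘ Tuple.sort ri, v ∘ Tuple.sort ri,
    (Tuple.monotone_sort ri).strictMono_of_injective (hri.comp (Tuple.sort ri).injective),
    fun h0 => hv ?_, fun j => ?_⟩
  · funext i
    simpa using congrFun h0 ((Tuple.sort ri).symm i)
  · obtain ⟨j, rfl⟩ := Finite.surjective_of_injective hci j
    have := congrFun hvM j
    simp only [Matrix.vecMul, dotProduct, vand, Matrix.submatrix_apply, Matrix.of_apply,
      Pi.zero_apply] at this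
    rw [← this]
    exact Equiv.sum_comp (Tuple.sort ri) fun i => v i * ξ (ci j) ^ (ri i : ℕ)

theorem stmt_7 {F : Type*} [Field F] [Fintype F] (p w k : ℕ)
    (hp : p.Prime) (hw : 1 < w) (hq : Fintype.card F = p ^ w)
    (hk : k < Fintype.card F)
    (θ : F) (hθ : orderOf θ = Fintype.card F - 1)
    (σ : F ≃+* F) (hσ : σ ≠ RingEquiv.refl F)
    (hfix : ∀ x : F, σ x = x ↔ x ∈ (⊥ : Subfield F)) :
    (∃ (ri : Fin 3 → Fin k) (ci : Fin 3 → Fin 3),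
        Function.Injective ri ∧ Function.Injective ci ∧
        ((vand k 3 ![1, θ, σ θ]).submatrix ri ci).det = 0) ↔
      ∃ (e₁ e₂ : ℕ) (c₁ c₂ : F), 1 ≤ e₁ ∧ e₁ < e₂ ∧ e₂ ≤ k - 1 ∧
        c₁ ∈ (⊥ : Subfield F) ∧ c₂ ∈ (⊥ : Subfield F) ∧ c₁ ≠ 0 ∧ c₂ ≠ 0 ∧
        ∀ x ∈ ({1, θ, σ θ} : Set F), c₁ + c₂ * x ^ e₁ + x ^ e₂ = 0 := by
  have hθ₀ : θ ≠ 0 := by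
    rintro rfl
    have := Fintype.one_lt_card (α := F)
    rw [orderOf_zero] at hθ
    lia
  constructor
  · rintro ⟨ri, ci, hri, hci, hdet⟩
    obtain ⟨s, v, hs, hv, hrel⟩ := exists_row_relation_of_det_eq_zero hri hci hdet
    have h01 : (s 0 : ℕ) < s 1 := hs (by decide)
    have h12 : (s 1 : ℕ) < s 2 := hs (by decide)
    have h2 := (s 2).isLt
    obtain ⟨c₁, c₂, hc₁, hc₂, hc₁0, hc₂0, r₁, rθ, rσ⟩ :=
      exists_fixed_trinomial σ hθ₀ (a := v 0) (b := v 1) (c := v 2) h01 h12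
        (fun e he hel => pow_ne_one_of_lt_orderOf he.ne' (by lia))
        (fun ⟨h0, h1, h2⟩ => hv (by funext i; fin_cases i <;> assumption))
        (by simpa [Fin.sum_univ_three] using hrel 0)
        (by simpa [Fin.sum_univ_three] using hrel 1)
        (by simpa [Fin.sum_univ_three] using hrel 2)
    refine ⟨s 1 - s 0, s 2 - s 0, c₁, c₂, by lia, by lia, by lia, (hfix _).mp hc₁,
      (hfix _).mp hc₂, hc₁0, hc₂0, ?_⟩
    rintro x (rfl | rfl | rfl)
    · simpa using r₁
    · exact rθ
    · exact rσ
  · rintro ⟨e₁, e₂, c₁, c₂, he₁, he₁₂, he₂, -, -, -, -, hroots⟩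
    refine ⟨![⟨0, by lia⟩, ⟨e₁, by lia⟩, ⟨e₂, by lia⟩], id, ?_, Function.injective_id, ?_⟩
    · refine StrictMono.injective (Fin.strictMono_iff_lt_succ.mpr fun i => ?_)
      fin_cases i
      · exact Fin.mk_lt_mk.mpr he₁
      · exact Fin.mk_lt_mk.mpr he₁₂
    · refine Matrix.exists_vecMul_eq_zero_iff.mp
        ⟨![c₁, c₂, 1], fun h => one_ne_zero (α := F) (congrFun h 2), ?_⟩
      funext j
      have := hroots (![1, θ, σ θ] j) (by fin_cases j <;> simp)
      simpa [Matrix.vecMul, dotProduct, Fin.sum_univ_three, vand] using this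
end

section
/- Let q = p^w be a prime power with w > 1, let k ≤ w, let θ be a primitive element of F_q, and let σ be a nontrivial field automorphism of F_q whose fixed field is the prime subfield F_p. Then the k×3 Vandermonde matrix V_k(1, θ, σ(θ)) is super-regular. -/
theorem adjoin_eq_top_of_orderOf {F : Type*} [Field F] [Fintype F] (K : Subfield F)
    {θ : F} (hθ : orderOf θ = Fintype.card F - 1) : IntermediateField.adjoin K {θ} = ⊤ := by
  classical
  have hcard : 1 < Fintype.card F := Fintype.one_lt_card
  have hθ0 : θ ≠ 0 := by
    rintro rfl
    rw [orderOf_zero] at hθ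
    omega
  have hunit : orderOf (Units.mk0 θ hθ0) = Nat.card Fˣ := by
    rw [← orderOf_units, Units.val_mk0, hθ, Nat.card_eq_fintype_card, Fintype.card_units]
  rw [eq_top_iff]
  intro x _
  by_cases hx : x = 0
  · rw [hx]; exact zero_mem _
  · have hmem : Units.mk0 x hx ∈ Subgroup.zpowers (Units.mk0 θ hθ0) := by
      rw [(Subgroup.eq_top_of_card_eq _ (by rw [Nat.card_zpowers, hunit]) :
        Subgroup.zpowers (Units.mk0 θ hθ0) = ⊤)]
      trivial
    obtain ⟨n, hn⟩ := Subgroup.mem_zpowers_iff.mp hmem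
    have hval : θ ^ n = x := by simpa using congrArg Units.val hn
    rw [← hval]
    exact zpow_mem (IntermediateField.mem_adjoin_simple_self K θ) n

theorem finrank_bot_of_card {F : Type*} [Field F] [Fintype F] {p w : ℕ} (hp : p.Prime)
    (hq : Fintype.card F = p ^ w) : Module.finrank (⊥ : Subfield F) F = w := by
  classical
  have : Fact p.Prime := ⟨hp⟩
  have : CharP F p := by
    obtain ⟨n, hr, hn⟩ := FiniteField.card F (ringChar F)
    have hw : w ≠ 0 := by
      rintro rfl
      have : 1 < Fintype.card F := Fintype.one_lt_card
      simp [hq] at this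
    have hdvd : p ∣ ringChar F ^ (n : ℕ) := by
      rw [← hn, hq]; exact dvd_pow_self p hw
    have := (Nat.prime_dvd_prime_iff_eq hp hr).mp (hp.dvd_of_dvd_pow hdvd)
    rw [this]; infer_instance
  have hbot : Nat.card (⊥ : Subfield F) = p := Subfield.card_bot F p
  have h := Module.natCard_eq_pow_finrank (K := (⊥ : Subfield F)) (V := F)
  rw [hbot, Nat.card_eq_fintype_card, hq] at h
  exact (Nat.pow_right_injective hp.two_le h).symm

/-- A primitive element satisfies no monic trinomial over the prime field of degree below
the degree of the extension. -/
theorem primitive_trinomial_ne_zero {F : Type*} [Field F] [Fintype F] {p w : ℕ} (hp : p.Prime)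
    (hq : Fintype.card F = p ^ w) {θ : F} (hθ : orderOf θ = Fintype.card F - 1)
    {a b : ℕ} (hab : a < b) (hb : b < w) (c e : (⊥ : Subfield F)) :
    θ ^ b + c * θ ^ a + e ≠ 0 := by
  intro h
  have hint : IsIntegral (⊥ : Subfield F) θ := Algebra.IsIntegral.isIntegral θ
  have hdeg : (minpoly (⊥ : Subfield F) θ).natDegree = w := by
    rw [← IntermediateField.adjoin.finrank hint, adjoin_eq_top_of_orderOf _ hθ,
      IntermediateField.finrank_top', finrank_bot_of_card hp hq]
  let P : Polynomial (⊥ : Subfield F) :=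
    Polynomial.X ^ b + (Polynomial.C c * Polynomial.X ^ a + Polynomial.C e)
  have hlow : (Polynomial.C c * Polynomial.X ^ a + Polynomial.C e).degree < (b : WithBot ℕ) := by
    refine (Polynomial.degree_add_le _ _).trans_lt (max_lt ?_ ?_)
    · exact (Polynomial.degree_C_mul_X_pow_le a c).trans_lt (by exact_mod_cast hab)
    · exact Polynomial.degree_C_le.trans_lt (by exact_mod_cast (Nat.zero_le a).trans_lt hab)
  have hPdeg : P.natDegree = b := by
    apply Polynomial.natDegree_eq_of_degree_eq_some
    rw [Polynomial.degree_add_eq_left_of_degree_lt] <;> rw [Polynomial.degree_X_pow]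
    exact hlow
  have hP0 : P ≠ 0 := (Polynomial.monic_X_pow_add hlow).ne_zero
  have hroot : Polynomial.aeval θ P = 0 := by
    have hc : ∀ x : (⊥ : Subfield F), algebraMap (⊥ : Subfield F) F x = x := fun _ => rfl
    simp only [P, map_add, map_mul, map_pow, Polynomial.aeval_X, Polynomial.aeval_C, hc]
    rw [← add_assoc]; exact h
  have := Polynomial.natDegree_le_of_dvd (minpoly.dvd _ θ hroot) hP0
  omega

theorem primitive_pow_notMem_bot {F : Type*} [Field F] [Fintype F] {p w : ℕ} (hp : p.Prime)
    (hq : Fintype.card F = p ^ w) {θ : F} (hθ : orderOf θ = Fintype.card F - 1)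
    {d : ℕ} (hd : 0 < d) (hdw : d < w) : θ ^ d ∉ (⊥ : Subfield F) := by
  intro h
  apply primitive_trinomial_ne_zero hp hq hθ hd hdw 0 (-⟨θ ^ d, h⟩)
  simp

theorem vand_column_pow_ne {F : Type*} [Field F] [Fintype F] {p w : ℕ} (hp : p.Prime)
    (hq : Fintype.card F = p ^ w) {θ : F} (hθ : orderOf θ = Fintype.card F - 1)
    {σ : F ≃+* F} (hfix : ∀ x : F, σ x = x ↔ x ∈ (⊥ : Subfield F))
    {d : ℕ} (hd : 0 < d) (hdw : d < w) {s t : Fin 3} (hst : s ≠ t) :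
    (![1, θ, σ θ] : Fin 3 → F) s ^ d ≠ (![1, θ, σ θ] : Fin 3 → F) t ^ d := by
  have hmem := primitive_pow_notMem_bot hp hq hθ hd hdw
  have h1 : θ ^ d ≠ 1 := fun h => hmem (h ▸ one_mem _)
  have h2 : σ θ ^ d ≠ θ ^ d := by
    rw [← map_pow]; exact fun h => hmem ((hfix _).mp h)
  have h3 : σ θ ^ d ≠ 1 := by
    rw [← map_pow]; exact fun h => h1 ((map_eq_one_iff σ σ.injective).mp h)
  fin_cases s <;> fin_cases t <;>
    simp_all [h1.symm, h2.symm, h3.symm]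

theorem pow_mul_pow_sub_ne_zero {F : Type*} [Field F] {w : ℕ} {x y : F} (hx : x ≠ 0) (hy : y ≠ 0)
    (h : ∀ d, 0 < d → d < w → x ^ d ≠ y ^ d) {i j : ℕ} (hi : i < w) (hj : j < w) (hij : i ≠ j) :
    x ^ i * y ^ j - y ^ i * x ^ j ≠ 0 := by
  wlog hlt : i < j generalizing i j
  · have := this hj hi hij.symm (by omega)
    intro h0
    exact this (by linear_combination -h0)
  obtain ⟨d, rfl⟩ := Nat.exists_eq_add_of_lt hlt
  intro h0
  have h1 : (x ^ i * y ^ i) * (y ^ (d + 1) - x ^ (d + 1)) = 0 := by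
    linear_combination h0
  refine h (d + 1) (by omega) (by omega) ?_
  have := (mul_eq_zero.mp h1).resolve_left (mul_ne_zero (pow_ne_zero _ hx) (pow_ne_zero _ hy))
  exact (sub_eq_zero.mp this).symm

theorem three_by_three_ne_zero {F : Type*} [Field F] [Fintype F] {p w : ℕ} (hp : p.Prime)
    (hq : Fintype.card F = p ^ w) {θ : F} (hθ : orderOf θ = Fintype.card F - 1) (hθ0 : θ ≠ 0)
    {σ : F ≃+* F} (hfix : ∀ x : F, σ x = x ↔ x ∈ (⊥ : Subfield F))
    {i j l : ℕ} (hij : i < j) (hjl : j < l) (hl : l < w) :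
    θ ^ j * σ θ ^ l - θ ^ l * σ θ ^ j - θ ^ i * σ θ ^ l + θ ^ l * σ θ ^ i
      + θ ^ i * σ θ ^ j - θ ^ j * σ θ ^ i ≠ 0 := by
  obtain ⟨a, rfl⟩ := Nat.exists_eq_add_of_le hij.le
  obtain ⟨b, rfl⟩ := Nat.exists_eq_add_of_le (hij.trans hjl).le
  intro h
  have hσ0 : σ θ ≠ 0 := (map_ne_zero_iff σ σ.injective).mpr hθ0
  have hfac : (θ ^ i * σ θ ^ i) *
      ((θ ^ a - 1) * (σ θ ^ b - 1) - (θ ^ b - 1) * (σ θ ^ a - 1)) = 0 := by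
    linear_combination h
  have hdet := (mul_eq_zero.mp hfac).resolve_left
    (mul_ne_zero (pow_ne_zero _ hθ0) (pow_ne_zero _ hσ0))
  have ha : θ ^ a - 1 ≠ 0 := fun h0 =>
    primitive_pow_notMem_bot hp hq hθ (d := a) (by omega) (by omega)
      (sub_eq_zero.mp h0 ▸ one_mem _)
  have hσa : σ θ ^ a - 1 ≠ 0 := by
    have := (map_ne_zero_iff σ σ.injective).mpr ha
    simpa using this
  have hu : (θ ^ b - 1) / (θ ^ a - 1) ∈ (⊥ : Subfield F) := by
    rw [← hfix]
    simp only [map_div₀, map_sub, map_pow, map_one]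
    rw [div_eq_div_iff hσa ha]
    linear_combination hdet
  obtain ⟨c, hc⟩ : ∃ c : (⊥ : Subfield F), (c : F) = (θ ^ b - 1) / (θ ^ a - 1) := ⟨⟨_, hu⟩, rfl⟩
  rw [eq_div_iff ha] at hc
  apply primitive_trinomial_ne_zero hp hq hθ (a := a) (b := b) (by omega) (by omega) (-c) (c - 1)
  push_cast
  linear_combination -hc

theorem stmt_8 {F : Type*} [Field F] [Fintype F] (p w k : ℕ)
    (hp : p.Prime) (hw : 1 < w) (hq : Fintype.card F = p ^ w)
    (hk : k ≤ w)
    (θ : F) (hθ : orderOf θ = Fintype.card F - 1)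
    (σ : F ≃+* F) (hσ : σ ≠ RingEquiv.refl F)
    (hfix : ∀ x : F, σ x = x ↔ x ∈ (⊥ : Subfield F)) :
    SuperRegular (vand k 3 ![1, θ, σ θ]) := by
  intro ℓ ri ci hri hci
  have hθ0 : θ ≠ 0 := by
    rintro rfl
    exact primitive_pow_notMem_bot hp hq hθ one_pos hw (by simp)
  have hσ0 : σ θ ≠ 0 := (map_ne_zero_iff σ σ.injective).mpr hθ0
  have hξ : ∀ s, (![1, θ, σ θ] : Fin 3 → F) s ≠ 0 := by
    intro s
    fin_cases s <;> simp [hθ0]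
  have hrow : ∀ s, (ri s : ℕ) < w := fun s => (ri s).isLt.trans_le hk
  have hne : ∀ s t, s ≠ t → (ri s : ℕ) ≠ ri t := fun s t hst h => hst (hri (Fin.ext h))
  have hℓ : ℓ ≤ 3 := by simpa using Fintype.card_le_of_injective ci hci
  interval_cases ℓ
  · simp
  · simp [vand, Matrix.det_unique, hξ]
  · rw [Matrix.det_fin_two]
    simp only [vand, Matrix.submatrix_apply, Matrix.of_apply]
    exact pow_mul_pow_sub_ne_zero (hξ _) (hξ _)
      (fun d hd hdw => vand_column_pow_ne hp hq hθ hfix hd hdw (hci.ne (by decide)))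
      (hrow 0) (hrow 1) (hne 0 1 (by decide))
  · let e : Equiv.Perm (Fin 3) := Equiv.ofBijective ci (Finite.injective_iff_bijective.mp hci)
    have hperm : (vand k 3 ![1, θ, σ θ]).submatrix ri ci =
        ((vand k 3 ![1, θ, σ θ]).submatrix ri id).submatrix id e := rfl
    rw [hperm, Matrix.det_permute']
    refine mul_ne_zero (by
      rcases Int.units_eq_one_or (Equiv.Perm.sign e) with h | h <;> simp [h]) ?_
    rw [Matrix.det_fin_three]
    simp only [vand, Matrix.submatrix_apply, Matrix.of_apply, id, Matrix.cons_val_zero,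
      Matrix.cons_val_one, Matrix.cons_val, one_pow]
    have h01 := hne 0 1 (by decide)
    have h02 := hne 0 2 (by decide)
    have h12 := hne 1 2 (by decide)
    have h0 := hrow 0
    have h1 := hrow 1
    have h2 := hrow 2
    generalize (ri 0 : ℕ) = a at *
    generalize (ri 1 : ℕ) = b at *
    generalize (ri 2 : ℕ) = c at *
    have key := fun {i j l : ℕ} => three_by_three_ne_zero (i := i) (j := j) (l := l)
      hp hq hθ hθ0 hfix
    intro h
    rcases lt_or_gt_of_ne h01 with hab | hab <;> rcases lt_or_gt_of_ne h02 with hac | hac <;>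
      rcases lt_or_gt_of_ne h12 with hbc | hbc
    · exact key hab hbc h2 (by linear_combination h)
    · exact key hac hbc h1 (by linear_combination -h)
    · omega
    · exact key hac hab h1 (by linear_combination h)
    · exact key hab hac h2 (by linear_combination -h)
    · omega
    · exact key hbc hac h0 (by linear_combination h)
    · exact key hbc hab h0 (by linear_combination -h)
end

section
/- Let q = 2^w be a power of 2 with w > 1, let k < q, let θ be a primitive element of F_q, and let σ be a nontrivial field automorphism of F_q whose fixed field is the prime subfield F_2. Then the k×3 Vandermonde matrix V_k(1, θ, σ(θ)) is super-regular. -/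
/-- If the only fixed points of `σ` are `0` and `1`, then two nonzero elements with
`u * σ v = v * σ u` coincide. -/
theorem eq_of_mul_map_eq_mul_map {F : Type*} [Field F] {σ : F ≃+* F}
    (hσ : ∀ x, σ x = x → x = 0 ∨ x = 1) {u v : F} (hu : u ≠ 0) (hv : v ≠ 0)
    (h : u * σ v = v * σ u) : u = v := by
  have hσu : σ u ≠ 0 := (map_ne_zero σ).2 hu
  have hfix : σ (v / u) = v / u := by
    rw [map_div₀, div_eq_div_iff hσu hu]
    linear_combination h
  rcases hσ _ hfix with h0 | h1
  · exact absurd h0 (div_ne_zero hv hu)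
  · exact ((div_eq_one_iff_eq hu).1 h1).symm

theorem stmt_9 {F : Type*} [Field F] [Fintype F] (w k : ℕ)
    (hw : 1 < w) (hq : Fintype.card F = 2 ^ w)
    (hk : k < Fintype.card F)
    (θ : F) (hθ : orderOf θ = Fintype.card F - 1)
    (σ : F ≃+* F) (hσ : σ ≠ RingEquiv.refl F)
    (hfix : ∀ x : F, σ x = x ↔ x ∈ (⊥ : Subfield F)) :
    SuperRegular (vand k 3 ![1, θ, σ θ]) := by
  have : Fact (Nat.Prime 2) := ⟨Nat.prime_two⟩
  have : CharP F 2 := charP_of_card_eq_prime_pow hq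
  have hσ01 (x : F) (hx : σ x = x) : x = 0 ∨ x = 1 := by
    have h := (Subfield.mem_bot_iff_pow_eq_self F 2).1 ((hfix x).1 hx)
    have h' : x * (x - 1) = 0 := by linear_combination h
    exact (mul_eq_zero.1 h').imp_right sub_eq_zero.1
  have hθ0 : θ ≠ 0 := by
    rintro rfl
    have hcard : 2 ^ 1 < 2 ^ w := Nat.pow_lt_pow_right one_lt_two hw
    rw [orderOf_zero] at hθ
    omega
  have hinj (i j : Fin k) (h : θ ^ (i : ℕ) = θ ^ (j : ℕ)) : i = j := by
    refine Fin.ext (pow_injOn_Iio_orderOf ?_ ?_ h) <;> rw [hθ, Set.mem_Iio] <;> omega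
  have hne (i : ℕ) : θ ^ i ≠ 0 := pow_ne_zero i hθ0
  have hkey (i j : Fin k) (h : θ ^ (i : ℕ) * σ (θ ^ (j : ℕ)) = θ ^ (j : ℕ) * σ (θ ^ (i : ℕ))) :
      i = j :=
    hinj i j (eq_of_mul_map_eq_mul_map hσ01 (hne i) (hne j) h)
  have hσinj (i j : Fin k) (h : σ (θ ^ (i : ℕ)) = σ (θ ^ (j : ℕ))) : i = j :=
    hinj i j (σ.injective h)
  have hvand : vand k 3 ![1, θ, σ θ] =
      Matrix.of fun i : Fin k => ![1, θ ^ (i : ℕ), σ (θ ^ (i : ℕ))] := by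
    ext i j
    fin_cases j <;> simp [vand]
  rw [hvand]
  intro ℓ ri ci hri hci hdet
  have hℓ : ℓ ≤ 3 := by simpa using Fintype.card_le_of_injective ci hci
  interval_cases ℓ
  · simp at hdet
  · rw [Matrix.det_fin_one, Matrix.submatrix_apply, Matrix.of_apply] at hdet
    generalize ci 0 = c at hdet
    fin_cases c <;> simp [hθ0] at hdet
  · have hr : ri 0 ≠ ri 1 := hri.ne (by decide)
    have hc : ci 0 ≠ ci 1 := hci.ne (by decide)
    apply hr
    simp only [Matrix.det_fin_two, Matrix.submatrix_apply, Matrix.of_apply] at hdet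
    generalize ci 0 = c, ci 1 = d at hdet hc
    generalize ri 0 = a, ri 1 = b at hdet
    fin_cases c <;> fin_cases d <;>
      simp only [Fin.zero_eta, Fin.mk_one, Fin.reduceFinMk, ne_eq, not_true_eq_false,
        Matrix.cons_val] at hdet hc
    · exact hinj _ _ (by linear_combination -hdet)
    · exact hσinj _ _ (by linear_combination -hdet)
    · exact hinj _ _ (by linear_combination hdet)
    · exact hkey _ _ (by linear_combination hdet)
    · exact hσinj _ _ (by linear_combination hdet)
    · exact hkey _ _ (by linear_combination -hdet)
  · have h01 : ri 0 ≠ ri 1 := hri.ne (by decide)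
    have h02 : ri 0 ≠ ri 2 := hri.ne (by decide)
    have h12 : ri 1 ≠ ri 2 := hri.ne (by decide)
    let e : Equiv.Perm (Fin 3) := Equiv.ofBijective ci (Finite.injective_iff_bijective.1 hci)
    have hsub := Matrix.det_permute' e
      ((Matrix.of fun i : Fin k => ![1, θ ^ (i : ℕ), σ (θ ^ (i : ℕ))]).submatrix ri id)
    rw [Matrix.submatrix_submatrix] at hsub
    have hdet' := hsub.symm.trans hdet
    rw [mul_eq_zero, or_iff_right (by
      rcases Int.units_eq_one_or (Equiv.Perm.sign e) with h | h <;> simp [h])] at hdet'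
    simp only [Matrix.det_fin_three, Matrix.submatrix_apply, Matrix.of_apply, id,
      Matrix.cons_val] at hdet'
    refine h12 (hinj _ _ (sub_left_injective (eq_of_mul_map_eq_mul_map hσ01
      (u := θ ^ (ri 1 : ℕ) - θ ^ (ri 0 : ℕ)) (v := θ ^ (ri 2 : ℕ) - θ ^ (ri 0 : ℕ))
      (sub_ne_zero.2 fun h => h01 (hinj _ _ h).symm)
      (sub_ne_zero.2 fun h => h02 (hinj _ _ h).symm) ?_)))
    rw [map_sub, map_sub]
    linear_combination hdet'
end

section
/- Let q = 2^w be a power of 2 with w > 1, let k < q, and let θ be a primitive element of F_q. Then the k×3 Vandermonde matrix V_k(1, θ, θ^2) is super-regular. -/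
theorem det_pow_fin_two_ne_zero {F : Type*} [Field F] [CharP F 2] (x : Fin 2 → F)
    (hx : Function.Injective x) (h0 : ∀ i, x i ≠ 0) (c : Fin 2 → Fin 3)
    (hc : Function.Injective c) :
    (Matrix.of fun i j => x i ^ (c j : ℕ)).det ≠ 0 := by
  have hne : x 0 - x 1 ≠ 0 := sub_ne_zero.2 (hx.ne (by decide))
  have hcne : c 0 ≠ c 1 := hc.ne (by decide)
  have hsq : x 0 ^ 2 - x 1 ^ 2 ≠ 0 := by
    rw [← sub_pow_char]
    exact pow_ne_zero 2 hne
  have hmul : x 0 * x 1 * (x 0 - x 1) ≠ 0 := mul_ne_zero (mul_ne_zero (h0 0) (h0 1)) hne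
  rw [Matrix.det_fin_two]
  simp only [Matrix.of_apply]
  generalize c 0 = a at *
  generalize c 1 = b at *
  fin_cases a <;> fin_cases b <;> first | exact absurd rfl hcne | skip
  all_goals grind

theorem det_pow_fin_three_ne_zero {F : Type*} [Field F] (x : Fin 3 → F)
    (hx : Function.Injective x) (c : Fin 3 → Fin 3) (hc : Function.Injective c) :
    (Matrix.of fun i j => x i ^ (c j : ℕ)).det ≠ 0 := by
  have h := Matrix.det_permute' (Equiv.ofBijective c (Finite.injective_iff_bijective.1 hc))
    (Matrix.vandermonde x)
  have hM : (Matrix.of fun i j => x i ^ (c j : ℕ)) =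
      (Matrix.vandermonde x).submatrix id
        (Equiv.ofBijective c (Finite.injective_iff_bijective.1 hc)) := by
    ext i j
    simp [Matrix.vandermonde_apply]
  rw [hM, h]
  refine mul_ne_zero ?_ (Matrix.det_vandermonde_ne_zero_iff.2 hx)
  exact ((Equiv.Perm.sign _).isUnit.map (Int.castRingHom F)).ne_zero

theorem stmt_10 {F : Type*} [Field F] [Fintype F] (w k : ℕ)
    (hw : 1 < w) (hq : Fintype.card F = 2 ^ w)
    (hk : k < Fintype.card F)
    (θ : F) (hθ : orderOf θ = Fintype.card F - 1) :
    SuperRegular (vand k 3 ![1, θ, θ ^ 2]) := by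
  have : Fact (Nat.Prime 2) := ⟨Nat.prime_two⟩
  have : CharP F 2 := charP_of_card_eq_prime_pow (f := w) hq
  have hcard := Fintype.one_lt_card (α := F)
  have hθ0 : θ ≠ 0 := by
    rintro rfl
    rw [orderOf_zero] at hθ
    omega
  intro ℓ r c hr hc
  have hx : Function.Injective fun i => θ ^ (r i : ℕ) := by
    intro i j hij
    have hi := (r i).isLt
    have hj := (r j).isLt
    exact hr (Fin.ext (pow_injOn_Iio_orderOf (Set.mem_Iio.2 (by omega))
      (Set.mem_Iio.2 (by omega)) hij))
  have h0 : ∀ i, θ ^ (r i : ℕ) ≠ 0 := fun i => pow_ne_zero _ hθ0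
  have hM : (vand k 3 ![1, θ, θ ^ 2]).submatrix r c =
      Matrix.of fun i j => (θ ^ (r i : ℕ)) ^ (c j : ℕ) := by
    ext i j
    simp only [vand, Matrix.submatrix_apply, Matrix.of_apply]
    generalize c j = b
    fin_cases b <;> simp [pow_right_comm]
  have hℓ : ℓ ≤ 3 := by simpa using Fintype.card_le_of_injective c hc
  rw [hM]
  interval_cases ℓ
  · simp
  · simp [hθ0]
  · exact det_pow_fin_two_ne_zero _ hx h0 c hc
  · exact det_pow_fin_three_ne_zero _ hx c hc
end

section
/- Let θ be a primitive element of the finite field F_256 with 256 elements, and let k < 256. Then each of the k×3 Vandermonde matrices V_k(1, θ, θ^2), V_k(1, θ, θ^8), V_k(1, θ, θ^{32}), and V_k(1, θ, θ^{128}) is super-regular. -/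
/-- Powers with exponent coprime to `|F| - 1` are injective on the nonzero elements of `F`. -/
theorem eq_of_pow_eq_pow_of_coprime_card_sub_one {F : Type*} [Field F] [Fintype F] {m : ℕ}
    (hm : (Fintype.card F - 1).Coprime m) {x y : F} (hx : x ≠ 0) (hy : y ≠ 0)
    (h : x ^ m = y ^ m) : x = y := by
  have hr : (y / x) ^ m = 1 := by
    rw [div_pow, h, div_self (pow_ne_zero m hy)]
  have hr' : (y / x) ^ (Fintype.card F - 1) = 1 :=
    FiniteField.pow_card_sub_one_eq_one _ (div_ne_zero hy hx)
  have h1 : orderOf (y / x) ∣ 1 := by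
    rw [← hm.gcd_eq_one]
    exact Nat.dvd_gcd (orderOf_dvd_of_pow_eq_one hr') (orderOf_dvd_of_pow_eq_one hr)
  rw [Nat.dvd_one, orderOf_eq_one_iff, div_eq_one_iff_eq hx] at h1
  exact h1.symm

/-- Distinct nonzero `x`, `y` satisfy `x * y ^ 2 ^ s ≠ y * x ^ 2 ^ s` when `2 ^ s - 1` is coprime
to `|F| - 1`. -/
theorem mul_two_pow_ne_mul_two_pow {F : Type*} [Field F] [Fintype F] {s : ℕ}
    (hs : (Fintype.card F - 1).Coprime (2 ^ s - 1)) {x y : F} (hx : x ≠ 0) (hy : y ≠ 0)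
    (hxy : x ≠ y) : x * y ^ 2 ^ s ≠ y * x ^ 2 ^ s := by
  intro h
  refine hxy (eq_of_pow_eq_pow_of_coprime_card_sub_one hs hx hy ?_)
  have hpow (z : F) : z ^ 2 ^ s = z ^ (2 ^ s - 1) * z := by
    rw [← pow_succ, Nat.sub_add_cancel Nat.one_le_two_pow]
  rw [hpow, hpow] at h
  refine mul_left_cancel₀ (mul_ne_zero hx hy) ?_
  linear_combination -h

/-- In characteristic two, `V_k(1, θ, θ ^ 2 ^ s)` is super-regular as soon as `k` is at most the
order of `θ` and `2 ^ s - 1` is coprime to `|F| - 1`. -/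
theorem superRegular_vand_two_pow {F : Type*} [Field F] [Fintype F] [CharP F 2] {k s : ℕ} {θ : F}
    (hθ : θ ≠ 0) (hk : k ≤ orderOf θ) (hs : (Fintype.card F - 1).Coprime (2 ^ s - 1)) :
    SuperRegular (vand k 3 ![1, θ, θ ^ 2 ^ s]) := by
  intro ℓ ri ci hri hci
  have hne (i : Fin ℓ) : θ ^ (ri i : ℕ) ≠ 0 := pow_ne_zero _ hθ
  have hinj {i j : Fin ℓ} (hij : i ≠ j) : θ ^ (ri i : ℕ) ≠ θ ^ (ri j : ℕ) := fun h =>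
    hij (hri (Fin.ext (pow_injOn_Iio_orderOf ((ri i).2.trans_le hk) ((ri j).2.trans_le hk) h)))
  have hfrob (x y : F) : (x - y) ^ 2 ^ s = x ^ 2 ^ s - y ^ 2 ^ s := sub_pow_char_pow x y s
  have hfrob_ne {x y : F} (hxy : x ≠ y) : x ^ 2 ^ s - y ^ 2 ^ s ≠ 0 := by
    rw [← hfrob]
    exact pow_ne_zero _ (sub_ne_zero.2 hxy)
  have hM : (vand k 3 ![1, θ, θ ^ 2 ^ s]).submatrix ri ci =
      Matrix.of fun i j => ![1, θ ^ (ri i : ℕ), (θ ^ (ri i : ℕ)) ^ 2 ^ s] (ci j) := by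
    ext i j
    simp only [vand, Matrix.submatrix_apply, Matrix.of_apply]
    generalize ci j = c
    fin_cases c <;> simp [pow_right_comm]
  rw [hM]
  have hℓ : ℓ ≤ 3 := by simpa using Fintype.card_le_of_injective ci hci
  interval_cases ℓ
  · simp
  · rw [Matrix.det_fin_one, Matrix.of_apply]
    generalize ci 0 = c
    fin_cases c <;> simp [hθ]
  · have h01 : θ ^ (ri 0 : ℕ) ≠ θ ^ (ri 1 : ℕ) := hinj (by decide)
    have hc : ci 0 ≠ ci 1 := hci.ne (by decide)
    have hmul := mul_two_pow_ne_mul_two_pow hs (hne 0) (hne 1) h01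
    have hsub := hfrob_ne h01
    rw [Matrix.det_fin_two]
    simp only [Matrix.of_apply]
    generalize ci 0 = c at *
    generalize ci 1 = d at *
    generalize θ ^ (ri 0 : ℕ) = a at *
    generalize θ ^ (ri 1 : ℕ) = b at *
    fin_cases c <;> fin_cases d <;> simp at hc ⊢ <;> grind
  · let σ : Equiv.Perm (Fin 3) := Equiv.ofBijective ci (Finite.injective_iff_bijective.1 hci)
    let N : Matrix (Fin 3) (Fin 3) F :=
      Matrix.of fun i j => ![1, θ ^ (ri i : ℕ), (θ ^ (ri i : ℕ)) ^ 2 ^ s] j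
    change (N.submatrix id σ).det ≠ 0
    have hN : N.det ≠ 0 := by
      have hmul := mul_two_pow_ne_mul_two_pow hs
        (sub_ne_zero.2 (hinj (i := 1) (j := 0) (by decide)))
        (sub_ne_zero.2 (hinj (i := 2) (j := 0) (by decide)))
        (sub_left_injective.ne (hinj (i := 1) (j := 2) (by decide)))
      rw [hfrob, hfrob] at hmul
      intro hdet
      rw [Matrix.det_fin_three] at hdet
      simp [N] at hdet
      exact hmul (by linear_combination hdet)
    rw [Matrix.det_permute']
    refine mul_ne_zero ?_ hN
    obtain h | h := Int.units_eq_one_or (Equiv.Perm.sign σ) <;> simp [h]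

theorem stmt_11 {F : Type*} [Field F] [Fintype F] (hq : Fintype.card F = 256)
    (k : ℕ) (hk : k < 256)
    (θ : F) (hθ : orderOf θ = 255) :
    SuperRegular (vand k 3 ![1, θ, θ ^ 2]) ∧
    SuperRegular (vand k 3 ![1, θ, θ ^ 8]) ∧
    SuperRegular (vand k 3 ![1, θ, θ ^ 32]) ∧
    SuperRegular (vand k 3 ![1, θ, θ ^ 128]) := by
  have : CharP F 2 := by
    obtain ⟨p, hp⟩ := CharP.exists F
    obtain ⟨n, hprime, hn⟩ := FiniteField.card F p
    have hdvd : p ∣ 2 ^ 8 := by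
      rw [show 2 ^ 8 = p ^ (n : ℕ) from hq.symm.trans hn]
      exact dvd_pow_self p n.ne_zero
    rwa [(Nat.prime_dvd_prime_iff_eq hprime Nat.prime_two).1 (hprime.dvd_of_dvd_pow hdvd)] at hp
  have hθ0 : θ ≠ 0 := by
    rintro rfl
    simp at hθ
  have hk' : k ≤ orderOf θ := by omega
  exact ⟨superRegular_vand_two_pow (s := 1) hθ0 hk' (by rw [hq]; norm_num),
    superRegular_vand_two_pow (s := 3) hθ0 hk' (by rw [hq]; norm_num),
    superRegular_vand_two_pow (s := 5) hθ0 hk' (by rw [hq]; norm_num),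
    superRegular_vand_two_pow (s := 7) hθ0 hk' (by rw [hq]; norm_num)⟩
end

section
/- Let q = 2^w be a power of 2, let ℓ ≥ 3, and let ξ_1, …, ξ_ℓ be pairwise distinct nonzero elements of F_q with ξ_1 + ξ_2 + … + ξ_ℓ = 0. Then the ℓ×ℓ matrix H whose (i,j) entry is ξ_j^{a_i}, where (a_1, …, a_ℓ) = (0, 1, …, ℓ−2, ℓ), is singular. -/
open Polynomial in
/-- The monic polynomial with roots `ξ j` has vanishing next-to-leading coefficient, so its
coefficients give a linear dependence between the rows. -/
theorem det_pow_skip_eq_zero {F : Type*} [Field F] (n : ℕ) (ξ : Fin (n + 1) → F)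
    (hsum : ∑ i, ξ i = 0) :
    (Matrix.of fun i j : Fin (n + 1) =>
      ξ j ^ (if (i : ℕ) = n then n + 1 else (i : ℕ))).det = 0 := by
  set p : F[X] := ∏ i, (X - C (ξ i)) with hp
  have hdeg : p.natDegree = n + 1 := by simp [hp, natDegree_prod_of_monic, monic_X_sub_C]
  have hmonic : p.Monic := monic_prod_X_sub_C ξ Finset.univ
  have hlead : p.coeff (n + 1) = 1 := hdeg ▸ hmonic.coeff_natDegree
  have hnext : p.coeff n = 0 := by
    have h : p.nextCoeff = 0 := by rw [hp, prod_X_sub_C_nextCoeff, hsum, neg_zero]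
    rwa [nextCoeff_of_natDegree_pos (by omega), hdeg, Nat.add_sub_cancel] at h
  rw [← Matrix.exists_vecMul_eq_zero_iff]
  refine ⟨fun i => p.coeff (if (i : ℕ) = n then n + 1 else (i : ℕ)), fun h => ?_, ?_⟩
  · simpa [hlead] using congrFun h (Fin.last n)
  · ext j
    have hroot : p.eval (ξ j) = 0 := by
      rw [hp, eval_prod]
      exact Finset.prod_eq_zero (Finset.mem_univ j) (by simp)
    rw [eval_eq_sum_range, hdeg, Finset.sum_range_succ, Finset.sum_range_succ, hnext, zero_mul,
      add_zero, ← Fin.sum_univ_eq_sum_range (fun i => p.coeff i * ξ j ^ i)] at hroot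
    simpa [Matrix.vecMul, dotProduct, Fin.sum_univ_castSucc, Fin.is_lt, Nat.ne_of_lt]
      using hroot

theorem stmt_13 {F : Type*} [Field F] [Fintype F] (w ℓ : ℕ)
    (hq : Fintype.card F = 2 ^ w) (hℓ : 3 ≤ ℓ)
    (ξ : Fin ℓ → F) (hdist : Function.Injective ξ) (hne : ∀ i, ξ i ≠ 0)
    (hsum : ∑ i, ξ i = 0) :
    (Matrix.of fun i j : Fin ℓ =>
      ξ j ^ (if (i : ℕ) = ℓ - 1 then ℓ else (i : ℕ))).det = 0 := by
  obtain ⟨n, rfl⟩ : ∃ n, ℓ = n + 1 := ⟨ℓ - 1, by omega⟩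
  exact det_pow_skip_eq_zero n ξ hsum
end
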